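/- For all n ≥ 3, the number of permutations of {1,...,n} avoiding the patterns 132, 2341, 3241, and 4321 equals 2n² - 8n + 11. -/

import Mathlib

/-- A function `π : Fin n → Fin n` contains the pattern `p : Fin k → ℕ` if there is a
strictly increasing choice of indices whose images under `π` have the same pairwise
order relations as the entries of `p`. -/
def Contains {n k : ℕ} (π : Fin n → Fin n) (p : Fin k → ℕ) : Prop :=
  ∃ f : Fin k → Fin n, StrictMono f ∧ ∀ i j, p i < p j ↔ π (f i) < π (f j)

/-- `π` avoids the pattern `p`. -/
def Avoids {n k : ℕ} (π : Fin n → Fin n) (p : Fin k → ℕ) : Prop := ¬ Contains π p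

/-- The set of permutations of `Fin n` avoiding the patterns 132, 2341 and 3241,
i.e. the 132-avoiding two-stack sortable permutations. -/
def TSS132 (n : ℕ) : Set (Fin n → Fin n) :=
  {π | Function.Bijective π ∧ Avoids π ![1,3,2] ∧ Avoids π ![2,3,4,1] ∧ Avoids π ![3,2,4,1]}

/-- The Pell numbers. -/
def pell : ℕ → ℕ
  | 0 => 0
  | 1 => 1
  | n+2 => 2 * pell (n+1) + pell n

open Function

section Patterns

variable {n : ℕ}

/-- `π` has no occurrence of the pattern 21. -/
def No21 (π : Fin n → Fin n) : Prop := ∀ i j, i < j → ¬ π j < π i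

/-- `π` has no occurrence of the pattern 132. -/
def No132 (π : Fin n → Fin n) : Prop :=
  ∀ i j k, i < j → j < k → ¬ (π i < π k ∧ π k < π j)

/-- `π` has no occurrence of the pattern 321. -/
def No321 (π : Fin n → Fin n) : Prop :=
  ∀ i j k, i < j → j < k → ¬ (π k < π j ∧ π j < π i)

/-- `π` has no occurrence of the pattern 2341. -/
def No2341 (π : Fin n → Fin n) : Prop :=
  ∀ i j k l, i < j → j < k → k < l → ¬ (π l < π i ∧ π i < π j ∧ π j < π k)

/-- `π` has no occurrence of the pattern 3241. -/
def No3241 (π : Fin n → Fin n) : Prop :=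
  ∀ i j k l, i < j → j < k → k < l → ¬ (π l < π j ∧ π j < π i ∧ π i < π k)

/-- `π` has no occurrence of the pattern 4321. -/
def No4321 (π : Fin n → Fin n) : Prop :=
  ∀ i j k l, i < j → j < k → k < l → ¬ (π l < π k ∧ π k < π j ∧ π j < π i)

theorem avoids_132_iff (π : Fin n → Fin n) : Avoids π ![1, 3, 2] ↔ No132 π := by
  refine ⟨fun h i j k hij hjk hπ => h ⟨![i, j, k], ?_, ?_⟩, ?_⟩
  · simp [Fin.strictMono_iff_lt_succ, Fin.forall_fin_succ, hij, hjk]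
  · simp [Fin.forall_fin_succ]
    omega
  · rintro h ⟨f, hf, hp⟩
    exact h (f 0) (f 1) (f 2) (hf (by decide)) (hf (by decide))
      ⟨(hp 0 2).1 (by decide), (hp 2 1).1 (by decide)⟩

theorem avoids_2341_iff (π : Fin n → Fin n) : Avoids π ![2, 3, 4, 1] ↔ No2341 π := by
  refine ⟨fun h i j k l hij hjk hkl hπ => h ⟨![i, j, k, l], ?_, ?_⟩, ?_⟩
  · simp [Fin.strictMono_iff_lt_succ, Fin.forall_fin_succ, hij, hjk, hkl]
  · simp [Fin.forall_fin_succ]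
    omega
  · rintro h ⟨f, hf, hp⟩
    exact h (f 0) (f 1) (f 2) (f 3) (hf (by decide)) (hf (by decide)) (hf (by decide))
      ⟨(hp 3 0).1 (by decide), (hp 0 1).1 (by decide), (hp 1 2).1 (by decide)⟩

theorem avoids_3241_iff (π : Fin n → Fin n) : Avoids π ![3, 2, 4, 1] ↔ No3241 π := by
  refine ⟨fun h i j k l hij hjk hkl hπ => h ⟨![i, j, k, l], ?_, ?_⟩, ?_⟩
  · simp [Fin.strictMono_iff_lt_succ, Fin.forall_fin_succ, hij, hjk, hkl]
  · simp [Fin.forall_fin_succ]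
    omega
  · rintro h ⟨f, hf, hp⟩
    exact h (f 0) (f 1) (f 2) (f 3) (hf (by decide)) (hf (by decide)) (hf (by decide))
      ⟨(hp 3 1).1 (by decide), (hp 1 0).1 (by decide), (hp 0 2).1 (by decide)⟩

theorem avoids_4321_iff (π : Fin n → Fin n) : Avoids π ![4, 3, 2, 1] ↔ No4321 π := by
  refine ⟨fun h i j k l hij hjk hkl hπ => h ⟨![i, j, k, l], ?_, ?_⟩, ?_⟩
  · simp [Fin.strictMono_iff_lt_succ, Fin.forall_fin_succ, hij, hjk, hkl]
  · simp [Fin.forall_fin_succ]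
    omega
  · rintro h ⟨f, hf, hp⟩
    exact h (f 0) (f 1) (f 2) (f 3) (hf (by decide)) (hf (by decide)) (hf (by decide))
      ⟨(hp 3 2).1 (by decide), (hp 2 1).1 (by decide), (hp 1 0).1 (by decide)⟩

end Patterns

/-- Permutations of `Fin n` avoiding 132, 2341, 3241 and 4321. -/
def av4321 (n : ℕ) : Set (Fin n → Fin n) :=
  {π | Injective π ∧ No132 π ∧ No2341 π ∧ No3241 π ∧ No4321 π}

/-- Permutations of `Fin n` avoiding 132, 2341 and 321. -/
def av321 (n : ℕ) : Set (Fin n → Fin n) :=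
  {π | Injective π ∧ No132 π ∧ No2341 π ∧ No321 π}

/-- Permutations of `Fin n` avoiding 21. -/
def av21 (n : ℕ) : Set (Fin n → Fin n) := {π | Injective π ∧ No21 π}

section Operations

variable {n : ℕ}

/-- Append a new maximum to a permutation. -/
def appendMax (σ : Fin n → Fin n) : Fin (n + 1) → Fin (n + 1) :=
  Fin.snoc (α := fun _ => Fin (n + 1)) (fun i => (σ i).castSucc) (Fin.last n)

/-- Prepend a new maximum to a permutation. -/
def prependMax (σ : Fin n → Fin n) : Fin (n + 1) → Fin (n + 1) :=
  Fin.cons (Fin.last n) (fun i => (σ i).castSucc)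

/-- Prepend two new maxima, in increasing order, to a permutation. -/
def prependTwoMax (σ : Fin n → Fin n) : Fin (n + 2) → Fin (n + 2) :=
  Fin.cons (Fin.last n).castSucc (Fin.cons (Fin.last (n + 1)) fun i => (σ i).castSucc.castSucc)

variable (σ : Fin n → Fin n)

@[simp] theorem appendMax_castSucc (i : Fin n) :
    appendMax σ i.castSucc = (σ i).castSucc := by simp [appendMax]

@[simp] theorem appendMax_last : appendMax σ (Fin.last n) = Fin.last n := by simp [appendMax]

@[simp] theorem prependMax_succ (i : Fin n) :
    prependMax σ i.succ = (σ i).castSucc := by simp [prependMax]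

@[simp] theorem prependMax_zero : prependMax σ 0 = Fin.last n := by simp [prependMax]

@[simp] theorem prependTwoMax_succ_succ (i : Fin n) :
    prependTwoMax σ i.succ.succ = (σ i).castSucc.castSucc := by simp [prependTwoMax]

@[simp] theorem prependTwoMax_zero :
    prependTwoMax σ 0 = (Fin.last n).castSucc := by simp [prependTwoMax]

@[simp] theorem prependTwoMax_one : prependTwoMax σ 1 = Fin.last (n + 1) := rfl

theorem appendMax_injective : Injective (appendMax (n := n)) := fun σ τ h => funext fun i => by
  simpa using congrFun h i.castSucc

theorem prependMax_injective : Injective (prependMax (n := n)) := fun σ τ h => funext fun i => by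
  simpa using congrFun h i.succ

theorem prependTwoMax_injective : Injective (prependTwoMax (n := n)) :=
  fun σ τ h => funext fun i => by simpa using congrFun h i.succ.succ

theorem injective_appendMax_iff : Injective (appendMax σ) ↔ Injective σ := by
  simp only [Injective, Fin.forall_fin_succ', appendMax_castSucc, appendMax_last]
  simp [Fin.castSucc_ne_last, (Fin.castSucc_ne_last _).symm]

theorem injective_prependMax_iff : Injective (prependMax σ) ↔ Injective σ := by
  simp only [Injective, Fin.forall_fin_succ, prependMax_succ, prependMax_zero]
  simp [Fin.castSucc_ne_last, (Fin.castSucc_ne_last _).symm]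

theorem injective_prependTwoMax_iff : Injective (prependTwoMax σ) ↔ Injective σ := by
  simp only [Injective, Fin.forall_fin_succ, prependTwoMax_succ_succ, prependTwoMax_zero,
    Fin.succ_zero_eq_one, prependTwoMax_one]
  simp [Fin.castSucc_ne_last, (Fin.castSucc_ne_last _).symm]

theorem appendMax_mem_av4321 : appendMax σ ∈ av4321 (n + 1) ↔ σ ∈ av4321 n := by
  simp only [av4321, Set.mem_ofPred_eq, injective_appendMax_iff]
  simp [No132, No2341, No3241, No4321, Fin.forall_fin_succ', Fin.le_last]

theorem appendMax_mem_av321 : appendMax σ ∈ av321 (n + 1) ↔ σ ∈ av321 n := by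
  simp only [av321, Set.mem_ofPred_eq, injective_appendMax_iff]
  simp [No132, No2341, No321, Fin.forall_fin_succ', Fin.le_last]

theorem prependMax_mem_av4321 : prependMax σ ∈ av4321 (n + 1) ↔ σ ∈ av321 n := by
  simp only [av4321, av321, Set.mem_ofPred_eq, injective_prependMax_iff]
  simp [No132, No2341, No3241, No4321, No321, Fin.forall_fin_succ, Fin.le_last]
  grind

theorem prependMax_mem_av321 : prependMax σ ∈ av321 (n + 1) ↔ σ ∈ av21 n := by
  simp only [av321, av21, Set.mem_ofPred_eq, injective_prependMax_iff]
  simp [No132, No2341, No21, No321, Fin.forall_fin_succ, Fin.le_last]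
  grind

theorem prependTwoMax_mem_av4321 : prependTwoMax σ ∈ av4321 (n + 2) ↔ σ ∈ av321 n := by
  simp only [av4321, av321, Set.mem_ofPred_eq, injective_prependTwoMax_iff]
  simp [No132, No2341, No3241, No4321, No321, Fin.forall_fin_succ, Fin.le_last]
  grind

theorem prependTwoMax_mem_av321 : prependTwoMax σ ∈ av321 (n + 2) ↔ σ ∈ av21 n := by
  simp only [av321, av21, Set.mem_ofPred_eq, injective_prependTwoMax_iff]
  simp [No132, No2341, No21, No321, Fin.forall_fin_succ, Fin.le_last]
  grind

end Operations

section Decomposition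

variable {n : ℕ}

theorem exists_appendMax_eq {π : Fin (n + 1) → Fin (n + 1)} (hπ : Injective π)
    (h : π (Fin.last n) = Fin.last n) : ∃ σ, appendMax σ = π := by
  have hne (i : Fin n) : π i.castSucc ≠ Fin.last n := fun hi =>
    Fin.castSucc_ne_last i (hπ (hi.trans h.symm))
  refine ⟨fun i => (π i.castSucc).castPred (hne i), funext fun i => ?_⟩
  cases i using Fin.lastCases <;> simp [h]

theorem exists_prependMax_eq {π : Fin (n + 1) → Fin (n + 1)} (hπ : Injective π)
    (h : π 0 = Fin.last n) : ∃ σ, prependMax σ = π := by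
  have hne (i : Fin n) : π i.succ ≠ Fin.last n := fun hi =>
    Fin.succ_ne_zero i (hπ (hi.trans h.symm))
  refine ⟨fun i => (π i.succ).castPred (hne i), funext fun i => ?_⟩
  cases i using Fin.cases <;> simp [h]

theorem exists_prependTwoMax_eq {π : Fin (n + 2) → Fin (n + 2)} (hπ : Injective π)
    (h132 : No132 π) (h : π 1 = Fin.last (n + 1)) : ∃ σ, prependTwoMax σ = π := by
  have hne (i : Fin (n + 2)) (hi : i ≠ 1) : (π i : ℕ) < n + 1 := by
    have h1 : π i ≠ Fin.last (n + 1) := fun h' => hi (hπ (h'.trans h.symm))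
    have := Fin.lt_last_iff_ne_last.2 h1
    exact this
  have h0 : π 0 = (Fin.last n).castSucc := by
    obtain ⟨j, hj⟩ := Finite.injective_iff_surjective.1 hπ (Fin.last n).castSucc
    have hj1 : j ≠ 1 := by
      rintro rfl
      exact absurd (hj.symm.trans h) (Fin.castSucc_ne_last _)
    by_cases hj0 : j = 0
    · rwa [hj0] at hj
    · have h1j : (1 : Fin (n + 2)) < j := by
        have h0 : (j : ℕ) ≠ 0 := fun h => hj0 (Fin.ext h)
        have h1 : (j : ℕ) ≠ 1 := fun h => hj1 (Fin.ext h)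
        exact Fin.lt_def.2 (by rw [Fin.val_one]; omega)
      have hle : ¬ π 0 < π j := fun hlt =>
        h132 0 1 j (by simp) h1j ⟨hlt, by rw [h, hj]; exact Fin.castSucc_lt_last _⟩
      have := hne 0 (by simp)
      rw [hj] at hle
      simp only [Fin.lt_def, Fin.val_castSucc, Fin.val_last] at hle
      simp only [Fin.ext_iff, Fin.val_castSucc, Fin.val_last]
      omega
  have hlt (i : Fin n) : (π i.succ.succ : ℕ) < n := by
    have h1 := hne i.succ.succ (by simp [Fin.ext_iff])
    have h2 : π i.succ.succ ≠ π 0 := hπ.ne (Fin.succ_ne_zero _)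
    simp only [h0, ne_eq, Fin.ext_iff, Fin.val_castSucc, Fin.val_last] at h2
    omega
  refine ⟨fun i => ⟨π i.succ.succ, hlt i⟩, funext fun i => ?_⟩
  cases i using Fin.cases with
  | zero => simp [h0]
  | succ i =>
    cases i using Fin.cases with
    | zero => simp [h]
    | succ i => simp

theorem exists_decomposition {π : Fin (n + 3) → Fin (n + 3)} (hπ : Injective π)
    (h132 : No132 π) (h : No2341 π) (h' : No3241 π) :
    (∃ σ, appendMax σ = π) ∨ (∃ σ, prependMax σ = π) ∨ ∃ σ, prependTwoMax σ = π := by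
  obtain ⟨p, hp⟩ := Finite.injective_iff_surjective.1 hπ (Fin.last (n + 2))
  by_cases hp2 : p = Fin.last (n + 2)
  · exact .inl (exists_appendMax_eq hπ (hp2 ▸ hp))
  by_cases hp0 : p = 0
  · exact .inr (.inl (exists_prependMax_eq hπ (hp0 ▸ hp)))
  by_cases hp1 : p = 1
  · exact .inr (.inr (exists_prependTwoMax_eq hπ h132 (hp1 ▸ hp)))
  exfalso
  have h1p : 1 < p := by
    simp only [Fin.lt_def, Fin.ext_iff, Fin.val_zero, Fin.val_one] at *
    omega
  have hpl : p < Fin.last (n + 2) := Fin.lt_last_iff_ne_last.2 hp2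
  have hmax (i) (hi : i ≠ p) : π i < π p := by
    rw [hp]
    exact Fin.lt_last_iff_ne_last.2 fun hi' => hi (hπ (hi'.trans hp.symm))
  have hlast (i) (hi : i < p) : π (Fin.last (n + 2)) < π i :=
    lt_of_le_of_ne (not_lt.1 fun hlt => h132 i p _ hi hpl ⟨hlt, hmax _ hpl.ne'⟩)
      (hπ.ne (hi.trans hpl).ne')
  have h01 : (0 : Fin (n + 3)) < 1 := by simp
  rcases lt_or_gt_of_ne (hπ.ne h01.ne) with hlt | hlt
  · exact h 0 1 p _ h01 h1p hpl ⟨hlast 0 (h01.trans h1p), hlt, hmax 1 h1p.ne⟩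
  · exact h' 0 1 p _ h01 h1p hpl ⟨hlast 1 h1p, hlt, hmax 0 (h01.trans h1p).ne⟩

theorem ncard_of_decomposition {X : Set (Fin (n + 3) → Fin (n + 3))}
    {Y Z : Set (Fin (n + 2) → Fin (n + 2))} {W : Set (Fin (n + 1) → Fin (n + 1))}
    (hX : ∀ π ∈ X, (∃ σ, appendMax σ = π) ∨ (∃ σ, prependMax σ = π) ∨ ∃ σ, prependTwoMax σ = π)
    (hY : ∀ σ, appendMax σ ∈ X ↔ σ ∈ Y) (hZ : ∀ σ, prependMax σ ∈ X ↔ σ ∈ Z)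
    (hW : ∀ σ, prependTwoMax σ ∈ X ↔ σ ∈ W) :
    X.ncard = Y.ncard + Z.ncard + W.ncard := by
  have hU : X = appendMax '' Y ∪ prependMax '' Z ∪ prependTwoMax '' W := by
    ext π
    constructor
    · intro hπ
      rcases hX π hπ with ⟨σ, rfl⟩ | ⟨σ, rfl⟩ | ⟨σ, rfl⟩
      · exact .inl (.inl ⟨σ, (hY σ).1 hπ, rfl⟩)
      · exact .inl (.inr ⟨σ, (hZ σ).1 hπ, rfl⟩)
      · exact .inr ⟨σ, (hW σ).1 hπ, rfl⟩
    · rintro ((⟨σ, hσ, rfl⟩ | ⟨σ, hσ, rfl⟩) | ⟨σ, hσ, rfl⟩)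
      · exact (hY σ).2 hσ
      · exact (hZ σ).2 hσ
      · exact (hW σ).2 hσ
  have hAB : Disjoint (appendMax '' Y) (prependMax '' Z) := by
    rw [Set.disjoint_left]
    rintro _ ⟨σ, -, rfl⟩ ⟨τ, -, h⟩
    have := congrFun h (Fin.last (n + 1)).succ
    rw [prependMax_succ, Fin.succ_last, appendMax_last] at this
    exact Fin.castSucc_ne_last _ this
  have hABC : Disjoint (appendMax '' Y ∪ prependMax '' Z) (prependTwoMax '' W) := by
    rw [Set.disjoint_left]
    rintro _ (⟨σ, -, rfl⟩ | ⟨σ, -, rfl⟩) ⟨τ, -, h⟩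
    · have := congrFun h (Fin.last n).succ.succ
      rw [prependTwoMax_succ_succ, Fin.succ_last, Fin.succ_last, appendMax_last] at this
      exact Fin.castSucc_ne_last _ this
    · have := congrFun h 0
      rw [prependTwoMax_zero, prependMax_zero] at this
      exact Fin.castSucc_ne_last _ this
  rw [hU, Set.ncard_union_eq hABC, Set.ncard_union_eq hAB,
    Set.ncard_image_of_injective _ appendMax_injective,
    Set.ncard_image_of_injective _ prependMax_injective,
    Set.ncard_image_of_injective _ prependTwoMax_injective]

theorem No321.no3241 {π : Fin n → Fin n} (h : No321 π) : No3241 π :=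
  fun i j _ l hij hjk hkl hπ => h i j l hij (hjk.trans hkl) ⟨hπ.1, hπ.2.1⟩

end Decomposition

theorem ncard_av21 (n : ℕ) : (av21 n).ncard = 1 := by
  rw [Set.ncard_eq_one]
  refine ⟨id, Set.eq_singleton_iff_unique_mem.2
    ⟨⟨injective_id, fun i j hij => hij.le.not_gt⟩, fun π hπ => ?_⟩⟩
  have hmono : StrictMono π := fun i j hij =>
    lt_of_le_of_ne (not_lt.1 (hπ.2 i j hij)) (hπ.1.ne hij.ne)
  have hrange : Set.range π = Set.range (id : Fin n → Fin n) := by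
    rw [(Finite.injective_iff_surjective.1 hπ.1).range_eq, Set.range_id]
  exact (StrictMono.range_inj hmono strictMono_id).1 hrange

theorem ncard_av321_one : (av321 1).ncard = 1 := by
  rw [Set.ncard_eq_one]
  refine ⟨id, Set.eq_singleton_iff_unique_mem.2 ⟨?_, fun π _ => Subsingleton.elim _ _⟩⟩
  simp [av321, No132, No2341, No321, injective_id]

theorem av321_two : av321 2 = {π | Injective π} := by
  ext π
  simp [av321, No132, No2341, No321, Fin.forall_fin_succ]

theorem av4321_two : av4321 2 = {π | Injective π} := by
  ext π
  simp [av4321, No132, No2341, No3241, No4321, Fin.forall_fin_succ]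

theorem ncard_injective_two : {π : Fin 2 → Fin 2 | Injective π}.ncard = 2 := by
  rw [Set.ncard_eq_toFinset_card']
  decide

theorem ncard_av321 (n : ℕ) : (av321 (n + 2)).ncard = 2 * (n + 1) := by
  induction n with
  | zero => rw [av321_two, ncard_injective_two]
  | succ n ih =>
    rw [ncard_of_decomposition (fun π hπ => exists_decomposition hπ.1 hπ.2.1 hπ.2.2.1
      hπ.2.2.2.no3241) appendMax_mem_av321 prependMax_mem_av321 prependTwoMax_mem_av321,
      ih, ncard_av21, ncard_av21]
    ring

theorem ncard_av4321_succ (n : ℕ) :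
    (av4321 (n + 3)).ncard = (av4321 (n + 2)).ncard + (av321 (n + 2)).ncard +
      (av321 (n + 1)).ncard :=
  ncard_of_decomposition
    (fun _ hπ => exists_decomposition hπ.1 hπ.2.1 hπ.2.2.1 hπ.2.2.2.1)
    appendMax_mem_av4321 prependMax_mem_av4321 prependTwoMax_mem_av4321

theorem ncard_av4321 (n : ℕ) : (av4321 (n + 3)).ncard = 2 * n ^ 2 + 4 * n + 5 := by
  induction n with
  | zero =>
    rw [ncard_av4321_succ, av4321_two, av321_two, ncard_injective_two, ncard_av321_one]
    norm_num
  | succ n ih =>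
    rw [ncard_av4321_succ, ih, ncard_av321, ncard_av321]
    ring

theorem setOf_tss132_avoids_eq_av4321 (n : ℕ) :
    {π ∈ TSS132 n | Avoids π ![4, 3, 2, 1]} = av4321 n := by
  ext π
  simp only [TSS132, av4321, Set.mem_ofPred_eq, avoids_132_iff, avoids_2341_iff, avoids_3241_iff,
    avoids_4321_iff, ← Finite.injective_iff_bijective]
  tauto

theorem stmt_13 (n : ℕ) (hn : 3 ≤ n) :
    (Nat.card ↥{π ∈ TSS132 n | Avoids π ![4,3,2,1]} : ℤ) = 2*n^2 - 8*n + 11 := by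
  obtain ⟨m, rfl⟩ := Nat.exists_eq_add_of_le' hn
  rw [setOf_tss132_avoids_eq_av4321, Nat.card_coe_set_eq, ncard_av4321]
  push_cast
  ring
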